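/- Let μ ≥ 1 and a ≥ 0, and let U = {(x,y) ∈ (0,∞)² : x ≤ μ(a+y) and y ≤ μ(a+x)}. Then ∫∫_U e^{−x−y} dx dy = 1 − (2/(1+μ))·e^{−μa}. -/

import Mathlib

open Real MeasureTheory

lemma integrableOn_exp_neg_sub_quadrant :
    IntegrableOn (fun p : ℝ × ℝ => Real.exp (-p.1 - p.2)) (Set.Ioi 0 ×ˢ Set.Ioi 0) := by
  have h : IntegrableOn (fun x : ℝ => Real.exp (-x)) (Set.Ioi 0) := integrableOn_exp_neg_Ioi 0
  have h2 := Integrable.mul_prod h h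
  rw [Measure.prod_restrict] at h2
  refine h2.congr (Filter.Eventually.of_forall fun p => ?_)
  simp only [← Real.exp_add, sub_eq_add_neg]

lemma integral_exp_neg_sub_quadrant :
    ∫ p in (Set.Ioi 0 ×ˢ Set.Ioi 0 : Set (ℝ × ℝ)), Real.exp (-p.1 - p.2) = 1 := by
  have h := setIntegral_prod_mul (μ := (volume : Measure ℝ)) (ν := (volume : Measure ℝ))
    (fun x : ℝ => Real.exp (-x)) (fun x : ℝ => Real.exp (-x)) (Set.Ioi 0) (Set.Ioi 0)
  rw [integral_exp_neg_Ioi_zero, one_mul] at h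
  rw [← h, Measure.volume_eq_prod]
  simp only [← Real.exp_add, sub_eq_add_neg]

lemma measurableSet_above_line (μ a : ℝ) :
    MeasurableSet {p : ℝ × ℝ | 0 < p.1 ∧ μ * (a + p.1) < p.2} :=
  (measurableSet_lt measurable_const measurable_fst).inter
    (measurableSet_lt ((measurable_fst.const_add a).const_mul μ) measurable_snd)

lemma integral_exp_neg_sub_above_line {μ a : ℝ} (hμ : 0 ≤ μ) (ha : 0 ≤ a) :
    ∫ p in {p : ℝ × ℝ | 0 < p.1 ∧ μ * (a + p.1) < p.2}, Real.exp (-p.1 - p.2)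
      = Real.exp (-(μ * a)) / (1 + μ) := by
  have hm := measurableSet_above_line μ a
  have hsub : {p : ℝ × ℝ | 0 < p.1 ∧ μ * (a + p.1) < p.2} ⊆ Set.Ioi 0 ×ˢ Set.Ioi 0 :=
    fun p hp => ⟨hp.1, lt_of_le_of_lt (mul_nonneg hμ (add_nonneg ha hp.1.le)) hp.2⟩
  have hi := (integrable_indicator_iff hm).2 (integrableOn_exp_neg_sub_quadrant.mono_set hsub)
  rw [← integral_indicator hm, Measure.volume_eq_prod, integral_prod _ hi]
  have inner (x : ℝ) :
      ∫ y, Set.indicator {p : ℝ × ℝ | 0 < p.1 ∧ μ * (a + p.1) < p.2}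
          (fun p => Real.exp (-p.1 - p.2)) (x, y)
        = (Set.Ioi 0).indicator
          (fun x => Real.exp (-(μ * a)) * Real.exp (-(1 + μ) * x)) x := by
    by_cases hx : 0 < x
    · have : (fun y => Set.indicator {p : ℝ × ℝ | 0 < p.1 ∧ μ * (a + p.1) < p.2}
          (fun p => Real.exp (-p.1 - p.2)) (x, y))
          = (Set.Ioi (μ * (a + x))).indicator (fun y => Real.exp (-x) * Real.exp (-y)) := by
        ext y
        simp [Set.indicator_apply, hx, ← Real.exp_add, sub_eq_add_neg]
      rw [this, integral_indicator measurableSet_Ioi, integral_const_mul, integral_exp_neg_Ioi,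
        Set.indicator_of_mem (Set.mem_Ioi.2 hx), ← Real.exp_add, ← Real.exp_add]
      ring_nf
    · simp [hx]
  simp_rw [inner]
  rw [integral_indicator measurableSet_Ioi, integral_const_mul,
    integral_exp_mul_Ioi (by linarith) 0]
  rw [mul_zero, Real.exp_zero, neg_div_neg_eq, mul_one_div]

/-- Joint failure probability Pr{E, H | S₁} for two colliding packets (case μ ≥ 1):
∫∫_U e^{−x−y} dx dy = 1 − (2/(1+μ))e^{−μa}, where U is the set of gain pairs for
which both SINRs are at most μ. -/
theorem joint_failure_integral_mu_ge_one (μ a : ℝ) (hμ : 1 ≤ μ) (ha : 0 ≤ a) :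
    (∫ p in {p : ℝ × ℝ | 0 < p.1 ∧ 0 < p.2 ∧ p.1 ≤ μ * (a + p.2) ∧ p.2 ≤ μ * (a + p.1)},
        Real.exp (-p.1 - p.2))
      = 1 - (2 / (1 + μ)) * Real.exp (-(μ * a)) := by
  have hμ0 : 0 ≤ μ := zero_le_one.trans hμ
  set A : Set (ℝ × ℝ) := {p | 0 < p.1 ∧ μ * (a + p.1) < p.2} with hA
  have hmA : MeasurableSet A := measurableSet_above_line μ a
  have hmB : MeasurableSet (Prod.swap ⁻¹' A) := measurable_swap hmA
  have hsubA : A ⊆ Set.Ioi 0 ×ˢ Set.Ioi 0 :=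
    fun p hp => ⟨hp.1, lt_of_le_of_lt (mul_nonneg hμ0 (add_nonneg ha hp.1.le)) hp.2⟩
  have hsubB : Prod.swap ⁻¹' A ⊆ Set.Ioi 0 ×ˢ Set.Ioi 0 :=
    fun p hp => ⟨(hsubA hp).2, (hsubA hp).1⟩
  have hlt {p : ℝ × ℝ} (hp : p ∈ A) : p.1 < p.2 := by
    obtain ⟨h1, h2⟩ := hp
    nlinarith [mul_nonneg hμ0 ha, mul_nonneg (sub_nonneg.2 hμ) h1.le]
  have hdisj : Disjoint A (Prod.swap ⁻¹' A) :=
    Set.disjoint_left.2 fun p hp hq => lt_asymm (hlt hp) (hlt hq)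
  have hU : {p : ℝ × ℝ | 0 < p.1 ∧ 0 < p.2 ∧ p.1 ≤ μ * (a + p.2) ∧ p.2 ≤ μ * (a + p.1)}
      = (Set.Ioi 0 ×ˢ Set.Ioi 0) \ (A ∪ Prod.swap ⁻¹' A) := by
    ext ⟨x, y⟩
    simp only [hA, Set.mem_ofPred_eq, Set.mem_sdiff, Set.mem_prod, Set.mem_Ioi, Set.mem_union,
      Set.mem_preimage, Prod.swap_prod_mk, not_or, not_and, not_lt]
    tauto
  have hB : ∫ p in Prod.swap ⁻¹' A, Real.exp (-p.1 - p.2) = ∫ p in A, Real.exp (-p.1 - p.2) := by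
    rw [Measure.volume_eq_prod, ← (Measure.measurePreserving_swap (μ := (volume : Measure ℝ))
      (ν := (volume : Measure ℝ))).setIntegral_preimage_emb
        MeasurableEquiv.prodComm.measurableEmbedding _ A]
    refine integral_congr_ae (Filter.Eventually.of_forall fun p => ?_)
    simp only [Prod.fst_swap, Prod.snd_swap]
    ring_nf
  have hint := integrableOn_exp_neg_sub_quadrant
  rw [hU, setIntegral_sdiff (hmA.union hmB) hint (Set.union_subset hsubA hsubB),
    setIntegral_union hdisj hmB (hint.mono_set hsubA) (hint.mono_set hsubB), hB,
    integral_exp_neg_sub_quadrant, integral_exp_neg_sub_above_line hμ0 ha]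
  ring
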